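/- For every rooted tree T with n leaves in which no vertex has exactly one child (a homeomorphically irreducible rooted tree), ρ_C(T) ≤ ρ_C(C_n), where C_n is the binary caterpillar with n leaves. -/

import Mathlib

open Matrix

/-- A rooted tree on a finite vertex type `V`, encoded by its root and the
parent function: the root is its own parent, and iterating the parent function
from any vertex eventually reaches the root.  (These conditions force the graph
whose edges join each non-root vertex to its parent to be a tree.) -/
structure TreeOn (V : Type) [Fintype V] [DecidableEq V] where
  root : V
  parent : V → V
  parent_root : parent root = root
  reaches : ∀ v, ∃ k, parent^[k] v = root

namespace TreeOn

variable {V : Type} [Fintype V] [DecidableEq V]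

/-- `u` is a (weak) ancestor of `v`: some iterate of the parent function sends
`v` to `u`.  (Any ancestor is reached within `Fintype.card V` steps, so the
bound makes the predicate decidable without changing its meaning.) -/
def IsAncestor (T : TreeOn V) (u v : V) : Prop :=
  ∃ k, k ≤ Fintype.card V ∧ T.parent^[k] v = u

instance (T : TreeOn V) (u v : V) : Decidable (T.IsAncestor u v) := by
  have h : T.IsAncestor u v ↔ ∃ k ∈ Finset.range (Fintype.card V + 1), T.parent^[k] v = u := by
    simp [IsAncestor, Nat.lt_succ_iff]
  rw [h]; infer_instance

/-- The level of a vertex: its distance to the root. -/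
def level (T : TreeOn V) (v : V) : ℕ := Nat.find (T.reaches v)

/-- The ancestral level `ℓ(v ∨ w)`: the level of the lowest common ancestor
of `v` and `w`, i.e. the greatest level of a common ancestor. -/
def lcaLevel (T : TreeOn V) (v w : V) : ℕ :=
  (Finset.univ.filter fun u => T.IsAncestor u v ∧ T.IsAncestor u w).sup T.level

/-- A leaf is a vertex with no children. -/
def IsLeaf (T : TreeOn V) (v : V) : Prop := ∀ u, T.parent u = v → u = v

instance (T : TreeOn V) : DecidablePred T.IsLeaf := fun v =>
  inferInstanceAs (Decidable (∀ u, T.parent u = v → u = v))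

/-- The type of leaves of `T`. -/
abbrev Leaf (T : TreeOn V) := {v : V // T.IsLeaf v}

/-- The ancestral matrix `C(T)`, indexed by the leaves of `T`, whose
`(v, w)` entry is the ancestral level `ℓ(v ∨ w)`. -/
noncomputable def ancMatrix (T : TreeOn V) : Matrix T.Leaf T.Leaf ℝ :=
  Matrix.of fun v w => (T.lcaLevel v.1 w.1 : ℝ)

/-- The ancestral spectral radius `ρ_C(T)`: the largest eigenvalue of `C(T)`. -/
noncomputable def rhoC (T : TreeOn V) : ℝ :=
  sSup {μ : ℝ | ∃ x : T.Leaf → ℝ, x ≠ 0 ∧ T.ancMatrix.mulVec x = μ • x}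

/-- The underlying simple graph of the tree: each non-root vertex is joined
to its parent. -/
def graph (T : TreeOn V) : SimpleGraph V :=
  SimpleGraph.fromRel fun u v => T.parent u = v ∧ u ≠ v

/-- The number of children (outdegree) of a vertex. -/
def childCount (T : TreeOn V) (v : V) : ℕ :=
  (Finset.univ.filter fun u => T.parent u = v ∧ u ≠ v).card

end TreeOn

namespace TreeOn

variable {V : Type} [Fintype V] [DecidableEq V]

/-- A rooted caterpillar: the internal (non-leaf) vertices are pairwise
comparable with respect to the ancestor relation, i.e. removing all leaves
yields a path with the root at one end. -/
def IsCaterpillar (T : TreeOn V) : Prop :=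
  ∀ v w : V, ¬ T.IsLeaf v → ¬ T.IsLeaf w → T.IsAncestor v w ∨ T.IsAncestor w v

/-- The binary caterpillar `C_n`: a rooted caterpillar in which every internal
vertex has exactly two children. -/
def IsBinaryCaterpillar (T : TreeOn V) : Prop :=
  T.IsCaterpillar ∧ ∀ v, ¬ T.IsLeaf v → T.childCount v = 2

end TreeOn

namespace TreeOn

section basics

variable {V : Type} [Fintype V] [DecidableEq V] (T : TreeOn V)

theorem iter_root (k : ℕ) : T.parent^[k] T.root = T.root :=
  Function.iterate_fixed T.parent_root k

theorem level_eq_zero {v : V} : T.level v = 0 ↔ v = T.root := by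
  unfold level
  rw [Nat.find_eq_zero]
  rfl

theorem level_parent {v : V} (h : v ≠ T.root) : T.level v = T.level (T.parent v) + 1 := by
  unfold level
  exact Nat.find_comp_succ (T.reaches v) (T.reaches (T.parent v)) h

theorem iter_level (v : V) : T.parent^[T.level v] v = T.root := Nat.find_spec (T.reaches v)

theorem level_parent' (v : V) : T.level (T.parent v) = T.level v - 1 := by
  by_cases h : v = T.root
  · subst h
    rw [T.parent_root, (T.level_eq_zero).2 rfl]
  · rw [T.level_parent h]; simp

theorem level_iter (k : ℕ) (v : V) : T.level (T.parent^[k] v) = T.level v - k := by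
  induction k with
  | zero => simp
  | succ k ih => rw [Function.iterate_succ_apply', level_parent', ih]; omega

theorem level_le_card (v : V) : T.level v ≤ Fintype.card V := by
  have : Function.Injective (fun i : Fin (T.level v) => T.parent^[i.1] v) := by
    intro i j h
    have h' := congrArg T.level h
    simp only [level_iter] at h'
    have := i.2
    have := j.2
    ext
    omega
  simpa using Fintype.card_le_of_injective _ this

theorem anc_iff {u v : V} : T.IsAncestor u v ↔ ∃ k, T.parent^[k] v = u := by
  constructor
  · rintro ⟨k, -, h⟩
    exact ⟨k, h⟩
  · rintro ⟨k, h⟩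
    rcases le_total k (T.level v) with hk | hk
    · exact ⟨k, hk.trans (T.level_le_card v), h⟩
    · refine ⟨T.level v, T.level_le_card v, ?_⟩
      have : u = T.root := by
        rw [← T.level_eq_zero, ← h, level_iter]; omega
      rw [this, iter_level]

theorem anc_refl (v : V) : T.IsAncestor v v := T.anc_iff.2 ⟨0, rfl⟩

theorem anc_trans {u v w : V} (h : T.IsAncestor u v) (h' : T.IsAncestor v w) :
    T.IsAncestor u w := by
  rw [anc_iff] at *
  obtain ⟨k, rfl⟩ := h
  obtain ⟨l, rfl⟩ := h'
  exact ⟨k + l, Function.iterate_add_apply _ _ _ _⟩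

theorem anc_root (v : V) : T.IsAncestor T.root v := T.anc_iff.2 ⟨_, T.iter_level v⟩

theorem anc_parent_self (v : V) : T.IsAncestor (T.parent v) v := T.anc_iff.2 ⟨1, rfl⟩

theorem anc_parent {u v : V} (h : T.IsAncestor u v) (hne : v ≠ u) :
    T.IsAncestor u (T.parent v) := by
  rw [anc_iff] at *
  obtain ⟨k, hk⟩ := h
  cases k with
  | zero => exact absurd hk hne
  | succ k => exact ⟨k, hk⟩

theorem anc_level {u v : V} (h : T.IsAncestor u v) :
    T.level u ≤ T.level v ∧ T.parent^[T.level v - T.level u] v = u := by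
  rw [anc_iff] at h
  obtain ⟨k, rfl⟩ := h
  rw [level_iter]
  refine ⟨by omega, ?_⟩
  rcases le_total k (T.level v) with hk | hk
  · congr 2; omega
  · have h1 : T.level v - (T.level v - k) = T.level v := by omega
    rw [h1, iter_level]
    symm
    rw [← T.level_eq_zero, level_iter]; omega

theorem anc_comp {u w a : V} (hu : T.IsAncestor u a) (hw : T.IsAncestor w a)
    (h : T.level u ≤ T.level w) : T.IsAncestor u w := by
  obtain ⟨h1, h2⟩ := T.anc_level hu
  obtain ⟨h3, h4⟩ := T.anc_level hw
  refine T.anc_iff.2 ⟨T.level w - T.level u, ?_⟩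
  rw [← h4, ← Function.iterate_add_apply, h4]
  convert h2 using 2
  omega

theorem anc_eq {u v : V} (h : T.IsAncestor u v) (hl : T.level v ≤ T.level u) : u = v := by
  obtain ⟨h1, h2⟩ := T.anc_level h
  have : T.level v - T.level u = 0 := by omega
  rw [this] at h2
  exact h2.symm

theorem leaf_anc {u v : V} (hu : T.IsLeaf u) (h : T.IsAncestor u v) : v = u := by
  rw [anc_iff] at h
  obtain ⟨k, hk⟩ := h
  induction k with
  | zero => exact hk
  | succ k ih =>
    rw [Function.iterate_succ_apply'] at hk
    exact ih (hu _ hk)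

theorem child_ne_root {c u : V} (h : T.parent c = u) (hne : c ≠ u) : c ≠ T.root := by
  rintro rfl
  exact hne (T.parent_root.symm.trans h)

theorem exists_child {v : V} (h : ¬ T.IsLeaf v) : ∃ c, T.parent c = v ∧ c ≠ v := by
  unfold IsLeaf at h
  push Not at h
  exact h

theorem exists_leaf (v : V) : ∃ l, T.IsLeaf l ∧ T.IsAncestor v l := by
  obtain ⟨m, hm, hmax⟩ := Finset.exists_max_image
    (Finset.univ.filter fun u => T.IsAncestor v u) T.level ⟨v, by simp [anc_refl]⟩
  simp only [Finset.mem_filter, Finset.mem_univ, true_and] at hm hmax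
  refine ⟨m, ?_, hm⟩
  by_contra hl
  obtain ⟨c, hc, hne⟩ := T.exists_child hl
  have h1 := T.level_parent (T.child_ne_root hc hne)
  have h2 := hmax c (T.anc_trans hm (hc ▸ T.anc_parent_self c))
  rw [hc] at h1
  omega

/-- leaves below `v` -/
def below (v : V) : Finset T.Leaf := Finset.univ.filter fun l => T.IsAncestor v l.1

theorem mem_below {v : V} {l : T.Leaf} : l ∈ T.below v ↔ T.IsAncestor v l.1 := by
  simp [below]

theorem below_nonempty (v : V) : (T.below v).Nonempty := by
  obtain ⟨l, hl, h⟩ := T.exists_leaf v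
  exact ⟨⟨l, hl⟩, T.mem_below.2 h⟩

theorem below_root : T.below T.root = Finset.univ := by
  ext l; simp [mem_below, anc_root]

theorem below_leaf (l : T.Leaf) : T.below l.1 = {l} := by
  ext m
  rw [mem_below, Finset.mem_singleton]
  constructor
  · intro h; exact Subtype.ext (T.leaf_anc l.2 h)
  · rintro rfl; exact T.anc_refl _

theorem below_subset {u v : V} (h : T.IsAncestor u v) : T.below v ⊆ T.below u := by
  intro l hl
  rw [mem_below] at *
  exact T.anc_trans h hl

theorem childCount_ge {v : V} (hT : T.childCount v ≠ 1) (h : ¬ T.IsLeaf v) :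
    2 ≤ T.childCount v := by
  obtain ⟨c, hc⟩ := T.exists_child h
  have : 0 < T.childCount v := Finset.card_pos.2 ⟨c, by simpa using hc⟩
  omega

theorem card_below_lt {u v : V} (hv : 2 ≤ T.childCount v) (h : T.IsAncestor v u)
    (hne : u ≠ v) : (T.below u).card < (T.below v).card := by
  apply Finset.card_lt_card
  refine Finset.ssubset_iff_subset_ne.2 ⟨T.below_subset h, fun heq => ?_⟩
  obtain ⟨c, hc, d, hd, hcd⟩ := Finset.one_lt_card.1 hv
  simp only [Finset.mem_filter, Finset.mem_univ, true_and] at hc hd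
  have hlv : T.level v < T.level u := by
    by_contra hlt
    exact hne (T.anc_eq h (by omega)).symm
  have key : ∀ c, T.parent c = v ∧ c ≠ v → T.IsAncestor c u := by
    intro c hc
    obtain ⟨l, hl⟩ := T.below_nonempty c
    have h1 : l ∈ T.below u := by
      rw [heq]
      exact T.below_subset (hc.1 ▸ T.anc_parent_self c) hl
    rw [mem_below] at hl h1
    have h2 := T.level_parent (T.child_ne_root hc.1 hc.2)
    rw [hc.1] at h2
    exact T.anc_comp hl h1 (by omega)
  have h1 := T.level_parent (T.child_ne_root hc.1 hc.2)
  have h2 := T.level_parent (T.child_ne_root hd.1 hd.2)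
  rw [hc.1] at h1
  rw [hd.1] at h2
  exact hcd (T.anc_eq (T.anc_comp (key c hc) (key d hd) (by omega)) (by omega))

theorem two_le_card_below {v : V} (hv : 2 ≤ T.childCount v) : 2 ≤ (T.below v).card := by
  have hnl : ¬ T.IsLeaf v := by
    intro hl
    have : T.childCount v = 0 := by
      unfold childCount
      rw [Finset.card_eq_zero, Finset.filter_eq_empty_iff]
      rintro c - ⟨h1, h2⟩
      exact h2 (hl c h1)
    omega
  obtain ⟨c, hc, hne⟩ := T.exists_child hnl
  have h1 := T.card_below_lt hv (hc ▸ T.anc_parent_self c) hne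
  have h2 := Finset.card_pos.2 (T.below_nonempty c)
  omega

theorem lcaLevel_eq (a b : V) : T.lcaLevel a b =
    (Finset.univ.filter fun u => u ≠ T.root ∧ T.IsAncestor u a ∧ T.IsAncestor u b).card := by
  set S := Finset.univ.filter fun u => T.IsAncestor u a ∧ T.IsAncestor u b with hS
  obtain ⟨m, hm, hmM⟩ := Finset.exists_mem_eq_sup S ⟨T.root, by simp [hS, anc_root]⟩ T.level
  have hM : T.lcaLevel a b = T.level m := hmM
  have hm' : T.IsAncestor m a ∧ T.IsAncestor m b := by simpa [hS] using hm
  rw [hM]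
  have : (Finset.Icc 1 (T.level m)).card = T.level m := by simp
  rw [← this]
  symm
  apply Finset.card_bij (fun u _ => T.level u)
  · intro u hu
    simp only [Finset.mem_filter, Finset.mem_univ, true_and] at hu
    rw [Finset.mem_Icc]
    refine ⟨?_, ?_⟩
    · have := mt (T.level_eq_zero).1 hu.1
      omega
    · rw [← hmM]
      exact Finset.le_sup (f := T.level) (by simp [hS, hu.2])
  · intro u hu w hw h
    simp only [Finset.mem_filter, Finset.mem_univ, true_and] at hu hw
    exact T.anc_eq (T.anc_comp hu.2.1 hw.2.1 h.le) h.ge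
  · intro k hk
    rw [Finset.mem_Icc] at hk
    have hl : T.level (T.parent^[T.level m - k] m) = k := by rw [level_iter]; omega
    have hA : T.IsAncestor (T.parent^[T.level m - k] m) m := T.anc_iff.2 ⟨_, rfl⟩
    refine ⟨T.parent^[T.level m - k] m, ?_, hl⟩
    simp only [Finset.mem_filter, Finset.mem_univ, true_and]
    refine ⟨?_, T.anc_trans hA hm'.1, T.anc_trans hA hm'.2⟩
    intro h
    rw [h, (T.level_eq_zero).2 rfl] at hl
    omega

theorem quad_eq (x : T.Leaf → ℝ) : x ⬝ᵥ (T.ancMatrix *ᵥ x) =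
    ∑ u ∈ Finset.univ.filter (fun u => u ≠ T.root), (∑ l ∈ T.below u, x l) ^ 2 := by
  have h1 : ∀ a b : T.Leaf, T.ancMatrix a b = ∑ u ∈ Finset.univ.filter (fun u => u ≠ T.root),
      (if T.IsAncestor u a.1 then (1 : ℝ) else 0) * (if T.IsAncestor u b.1 then (1 : ℝ) else 0) := by
    intro a b
    simp only [ancMatrix, Matrix.of_apply, lcaLevel_eq]
    rw [Finset.card_eq_sum_ones, ← Finset.filter_filter, Finset.sum_filter]
    push_cast
    refine Finset.sum_congr rfl fun u _ => ?_
    by_cases h : T.IsAncestor u a.1 <;> by_cases h' : T.IsAncestor u b.1 <;> simp [h, h']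
  have h2 : ∀ u, ∑ l ∈ T.below u, x l =
      ∑ l, (if T.IsAncestor u l.1 then (1 : ℝ) else 0) * x l := by
    intro u
    rw [below, Finset.sum_filter]
    refine Finset.sum_congr rfl fun l _ => ?_
    split_ifs <;> simp
  simp only [dotProduct, mulVec, h1, h2, sq, Finset.mul_sum, Finset.sum_mul]
  symm
  rw [Finset.sum_comm]
  refine Finset.sum_congr rfl fun a _ => ?_
  rw [Finset.sum_comm]
  refine Finset.sum_congr rfl fun b _ => ?_
  refine Finset.sum_congr rfl fun u _ => ?_
  ring

/-- internal non-root vertices -/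
abbrev Inn : Type := {v : V // v ≠ T.root ∧ ¬ T.IsLeaf v}

theorem quad_split (hr : ¬ T.IsLeaf T.root) (x : T.Leaf → ℝ) :
    x ⬝ᵥ (T.ancMatrix *ᵥ x) = ∑ l, x l ^ 2 + ∑ u : T.Inn, (∑ l ∈ T.below u.1, x l) ^ 2 := by
  rw [quad_eq, ← Finset.sum_filter_add_sum_filter_not _ (fun u => T.IsLeaf u)]
  congr 1
  · rw [Finset.filter_filter]
    rw [← Finset.sum_subtype (p := fun u => T.IsLeaf u)
      (f := fun u => (∑ l ∈ T.below u, x l) ^ 2)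
      (Finset.univ.filter fun u => u ≠ T.root ∧ T.IsLeaf u) ?_ |>.symm]
    · refine Finset.sum_congr rfl fun l _ => ?_
      rw [below_leaf]; simp
    · intro u
      simp only [Finset.mem_filter, Finset.mem_univ, true_and]
      constructor
      · exact fun h => h.2
      · intro h
        exact ⟨fun h' => hr (h' ▸ h), h⟩
  · rw [Finset.filter_filter]
    exact Finset.sum_subtype _ (by intro u; simp) _

/-- Counting for irreducible trees. -/
theorem count_T (hT : ∀ v, T.childCount v ≠ 1) {v : V} (hv : v ≠ T.root) :
    (Finset.univ.filter fun u => ¬ T.IsLeaf u ∧ ¬ T.IsAncestor v u).card + (T.below v).card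
      ≤ Fintype.card T.Leaf := by
  set U := Finset.univ.filter fun u => ¬ T.IsAncestor v u with hU
  set I := Finset.univ.filter fun u => ¬ T.IsLeaf u ∧ ¬ T.IsAncestor v u with hI
  have hrU : T.root ∈ U := by
    simp only [hU, Finset.mem_filter, Finset.mem_univ, true_and]
    intro h
    exact hv (T.anc_eq h (by rw [(T.level_eq_zero).2 rfl]; omega))
  have hvU : v ∉ U.erase T.root := by simp [hU, anc_refl]
  have hcard : (insert v (U.erase T.root)).card = U.card := by
    rw [Finset.card_insert_of_notMem hvU, Finset.card_erase_of_mem hrU]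
    have := Finset.card_pos.2 ⟨_, hrU⟩
    omega
  have h2 : 2 * I.card ≤ U.card := by
    rw [← hcard, Finset.card_eq_sum_card_fiberwise (s := insert v (U.erase T.root))
      (f := T.parent) (t := Finset.univ)
      (fun _ _ => Finset.mem_coe.2 (Finset.mem_univ _))]
    calc 2 * I.card = ∑ u ∈ I, 2 := by simp [mul_comm]
      _ ≤ ∑ u ∈ I, (Finset.filter (fun c => T.parent c = u) (insert v (U.erase T.root))).card := by
          refine Finset.sum_le_sum fun u hu => ?_
          simp only [hI, Finset.mem_filter, Finset.mem_univ, true_and] at hu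
          refine (T.childCount_ge (hT u) hu.1).trans (Finset.card_le_card ?_)
          intro c hc
          simp only [Finset.mem_filter, Finset.mem_univ, true_and, Finset.mem_insert,
            Finset.mem_erase, hU] at hc ⊢
          refine ⟨?_, hc.1⟩
          by_cases hcv : c = v
          · exact Or.inl hcv
          · refine Or.inr ⟨T.child_ne_root hc.1 hc.2, fun h => hu.2 ?_⟩
            rw [← hc.1]
            exact T.anc_parent h hcv
      _ ≤ _ := Finset.sum_le_sum_of_subset (Finset.subset_univ _)
  have h3 : U.card = I.card + (Finset.univ.filter fun l : T.Leaf => ¬ T.IsAncestor v l.1).card := by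
    rw [← Finset.card_filter_add_card_filter_not (s := U) (fun u => ¬ T.IsLeaf u)]
    congr 1
    · congr 1
      ext u; simp [hU, hI, and_comm]
    · symm
      apply Finset.card_bij (fun l _ => l.1)
      · intro l hl
        simp only [Finset.mem_filter, Finset.mem_univ, true_and, hU, not_not] at hl ⊢
        exact ⟨hl, l.2⟩
      · intro a _ b _ h; exact Subtype.ext h
      · intro u hu
        simp only [Finset.mem_filter, Finset.mem_univ, true_and, hU, not_not] at hu
        exact ⟨⟨u, hu.2⟩, by simpa using hu.1, rfl⟩
  have h4 : (T.below v).card + (Finset.univ.filter fun l : T.Leaf => ¬ T.IsAncestor v l.1).card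
      = Fintype.card T.Leaf := by
    rw [below, Finset.card_filter_add_card_filter_not, Finset.card_univ]
  omega

/-- Counting for binary trees. -/
theorem count_G (hG : ∀ v, ¬ T.IsLeaf v → T.childCount v = 2) :
    (Finset.univ.filter fun u => ¬ T.IsLeaf u).card + 1 = Fintype.card T.Leaf := by
  set I := Finset.univ.filter fun u => ¬ T.IsLeaf u with hI
  have h1 : (Finset.univ.erase T.root).card = 2 * I.card := by
    rw [Finset.card_eq_sum_card_fiberwise (f := T.parent) (t := I)]
    · rw [Finset.sum_congr rfl (g := fun _ => 2)]
      · simp [mul_comm]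
      · intro u hu
        simp only [hI, Finset.mem_filter, Finset.mem_univ, true_and] at hu
        rw [← hG u hu, childCount]
        congr 1
        ext c
        simp only [Finset.mem_filter, Finset.mem_univ, true_and, Finset.mem_erase, and_true]
        constructor
        · rintro ⟨h1, h2⟩
          refine ⟨h2, ?_⟩
          rintro rfl
          have := T.level_parent h1
          rw [h2] at this
          omega
        · rintro ⟨h1, h2⟩
          exact ⟨T.child_ne_root h1 h2, h1⟩
    · intro c hc
      simp only [Finset.coe_erase, Finset.coe_univ, Set.mem_sdiff, Set.mem_univ, true_and,
        Set.mem_singleton_iff] at hc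
      simp only [hI, Finset.coe_filter, Finset.mem_univ, true_and, Set.mem_ofPred_eq]
      intro hl
      have h2 := hl c rfl
      have := T.level_parent hc
      rw [← h2] at this
      omega
  have h2 : I.card + Fintype.card T.Leaf = Fintype.card V := by
    rw [Fintype.card_subtype, add_comm, hI, Finset.card_filter_add_card_filter_not,
      Finset.card_univ]
  rw [Finset.card_erase_of_mem (Finset.mem_univ _), Finset.card_univ] at h1
  have : 0 < Fintype.card V := Fintype.card_pos_iff.2 ⟨T.root⟩
  omega

theorem symm_ancMatrix : T.ancMatrix.IsHermitian := by
  ext a b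
  simp [ancMatrix, lcaLevel_eq, and_comm]

theorem rayleigh (y : T.Leaf → ℝ) : y ⬝ᵥ (T.ancMatrix *ᵥ y) ≤ T.rhoC * (y ⬝ᵥ y) := by
  have hfin : Set.Finite {μ : ℝ | ∃ x : T.Leaf → ℝ, x ≠ 0 ∧ T.ancMatrix.mulVec x = μ • x} := by
    refine (Module.End.finite_hasEigenvalue (Matrix.toLin' T.ancMatrix)).subset ?_
    rintro μ ⟨x, hx, h⟩
    exact Module.End.hasEigenvalue_of_hasEigenvector
      (x := x) ⟨Module.End.mem_eigenspace_iff.2 (by simpa using h), hx⟩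
  have hH : ((T.rhoC • (1 : Matrix T.Leaf T.Leaf ℝ)) - T.ancMatrix).IsHermitian := by
    refine Matrix.IsHermitian.sub ?_ T.symm_ancMatrix
    ext a b
    simp [Matrix.one_apply, eq_comm]
  have hP : ((T.rhoC • (1 : Matrix T.Leaf T.Leaf ℝ)) - T.ancMatrix).PosSemidef := by
    rw [hH.posSemidef_iff_eigenvalues_nonneg]
    intro i
    have h := hH.mulVec_eigenvectorBasis i
    have hne : (hH.eigenvectorBasis i : T.Leaf → ℝ) ≠ 0 := by
      intro h0
      have := hH.eigenvectorBasis.orthonormal.ne_zero i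
      apply this
      ext j
      exact congrFun h0 j
    have : T.rhoC - hH.eigenvalues i ≤ T.rhoC := by
      refine le_csSup hfin.bddAbove ⟨_, hne, ?_⟩
      rw [Matrix.sub_mulVec, Matrix.smul_mulVec, Matrix.one_mulVec] at h
      rw [sub_smul, ← h]
      simp
    simp only [Pi.zero_apply]
    linarith
  have := hP.dotProduct_mulVec_nonneg y
  rw [Matrix.sub_mulVec, Matrix.smul_mulVec, Matrix.one_mulVec, dotProduct_sub,
    dotProduct_smul] at this
  simp only [star_trivial, smul_eq_mul] at this
  linarith

end basics

end TreeOn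

namespace TreeOn

section main

variable {V W : Type} [Fintype V] [DecidableEq V] [Fintype W] [DecidableEq W]

theorem exists_equiv (T : TreeOn V) (G : TreeOn W)
    (hn : Fintype.card T.Leaf = Fintype.card G.Leaf) (x : T.Leaf → ℝ) :
    ∃ e : G.Leaf ≃ T.Leaf, ∀ p q : G.Leaf, G.level p.1 < G.level q.1 → x (e p) ≤ x (e q) := by
  let a : Fin (Fintype.card T.Leaf) ≃ T.Leaf := (Fintype.equivFin T.Leaf).symm
  let b : Fin (Fintype.card T.Leaf) ≃ G.Leaf := (Fintype.equivFinOfCardEq hn.symm).symm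
  let σ := Tuple.sort (x ∘ a)
  let τ := Tuple.sort ((fun l : G.Leaf => G.level l.1) ∘ b)
  have hσ : Monotone ((x ∘ a) ∘ σ) := Tuple.monotone_sort _
  have hτ : Monotone (((fun l : G.Leaf => G.level l.1) ∘ b) ∘ τ) := Tuple.monotone_sort _
  refine ⟨(τ.trans b).symm.trans (σ.trans a), fun p q h => ?_⟩
  obtain ⟨i, rfl⟩ := (τ.trans b).surjective p
  obtain ⟨j, rfl⟩ := (τ.trans b).surjective q
  simp only [Equiv.trans_apply, Equiv.symm_trans_apply, Equiv.symm_apply_apply] at h ⊢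
  apply hσ
  by_contra hij
  have := hτ (le_of_not_ge hij)
  simp only [Function.comp] at this
  omega

theorem sum_le_of_sep {ι : Type*} [DecidableEq ι] (y : ι → ℝ) (hy : ∀ i, 0 ≤ y i)
    (A L : Finset ι) (hc : A.card ≤ L.card) (hs : ∀ i ∈ L, ∀ j ∉ L, y j ≤ y i) :
    ∑ i ∈ A, y i ≤ ∑ i ∈ L, y i := by
  rw [← Finset.sum_inter_add_sum_sdiff A L, ← Finset.sum_inter_add_sum_sdiff L A,
    Finset.inter_comm L A]
  refine add_le_add le_rfl ?_
  have hc' : (A \ L).card ≤ (L \ A).card := by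
    have h1 := Finset.card_sdiff_add_card_inter A L
    have h2 := Finset.card_sdiff_add_card_inter L A
    rw [Finset.inter_comm L A] at h2
    omega
  rcases (A \ L).eq_empty_or_nonempty with h | h
  · rw [h, Finset.sum_empty]
    exact Finset.sum_nonneg fun i _ => hy i
  · obtain ⟨j, hj, hmax⟩ := Finset.exists_max_image _ y h
    calc ∑ i ∈ A \ L, y i ≤ (A \ L).card • y j := Finset.sum_le_card_nsmul _ _ _ hmax
      _ ≤ (L \ A).card • y j := by
          simp only [nsmul_eq_mul]
          have := hy j
          gcongr
      _ ≤ ∑ i ∈ L \ A, y i := by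
          refine Finset.card_nsmul_le_sum _ _ _ fun i hi => ?_
          exact hs i (Finset.mem_sdiff.1 hi).1 j (Finset.mem_sdiff.1 hj).2

theorem hall (T : TreeOn V) (G : TreeOn W)
    (hT : ∀ v, T.childCount v ≠ 1) (hG : G.IsBinaryCaterpillar)
    (hn : Fintype.card T.Leaf = Fintype.card G.Leaf) :
    ∃ f : T.Inn → G.Inn, Function.Injective f ∧
      ∀ v, (T.below v.1).card ≤ (G.below (f v).1).card := by
  have key := (Finset.all_card_le_biUnion_card_iff_exists_injective
    (fun v : T.Inn => Finset.univ.filter fun w : G.Inn =>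
      (T.below v.1).card ≤ (G.below w.1).card)).1 ?_
  · obtain ⟨f, hf, h⟩ := key
    exact ⟨f, hf, fun v => by simpa using h v⟩
  intro A
  rcases A.eq_empty_or_nonempty with rfl | hA
  · simp
  obtain ⟨v, hv, hmin⟩ := Finset.exists_min_image A (fun v => (T.below v.1).card) hA
  set s := (T.below v.1).card with hs
  have hs2 : 2 ≤ s := T.two_le_card_below (T.childCount_ge (hT v.1) v.2.2)
  have hrl : ¬ T.IsLeaf T.root := by
    intro h
    exact v.2.1 (T.leaf_anc h (T.anc_root _))
  -- upper bound for A
  have h1 : A.card ≤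
      (Finset.univ.filter fun u => ¬ T.IsLeaf u ∧ ¬ T.IsAncestor v.1 u).card := by
    have hsub : (A.erase v).map (Function.Embedding.subtype _) ⊆
        (Finset.univ.filter fun u => ¬ T.IsLeaf u ∧ ¬ T.IsAncestor v.1 u).erase T.root := by
      intro u hu
      simp only [Finset.mem_map, Finset.mem_erase, Function.Embedding.subtype_apply] at hu
      obtain ⟨u, ⟨hne, huA⟩, rfl⟩ := hu
      simp only [Finset.mem_erase, Finset.mem_filter, Finset.mem_univ, true_and]
      refine ⟨u.2.1, u.2.2, fun h => ?_⟩
      have := T.card_below_lt (T.childCount_ge (hT v.1) v.2.2) h (fun h' => hne (Subtype.ext h'))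
      have := hmin u huA
      omega
    have hle := Finset.card_le_card hsub
    have hr : T.root ∈ Finset.univ.filter fun u => ¬ T.IsLeaf u ∧ ¬ T.IsAncestor v.1 u := by
      simp only [Finset.mem_filter, Finset.mem_univ, true_and]
      refine ⟨hrl, fun h => v.2.1 (T.anc_eq h ?_)⟩
      rw [(T.level_eq_zero).2 rfl]; omega
    rw [Finset.card_map, Finset.card_erase_of_mem hv, Finset.card_erase_of_mem hr] at hle
    have := Finset.card_pos.2 ⟨_, hr⟩
    omega
  have h2 := T.count_T hT v.2.1
  -- lower bound for G
  have h3 := G.count_G hG.2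
  have h4 : (Finset.univ.filter fun w => ¬ G.IsLeaf w ∧ (G.below w).card < s).card ≤ s - 2 := by
    have : (Finset.Ico 2 s).card = s - 2 := by simp
    rw [← this]
    apply Finset.card_le_card_of_injOn (fun w => (G.below w).card)
    · intro w hw
      simp only [Finset.coe_filter, Finset.mem_univ, true_and, Set.mem_ofPred_eq] at hw
      simp only [Finset.coe_Ico, Set.mem_Ico]
      exact ⟨G.two_le_card_below (hG.2 w hw.1).ge, hw.2⟩
    · intro w hw w' hw' h
      simp only [Finset.coe_filter, Finset.mem_univ, true_and, Set.mem_ofPred_eq] at hw hw'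
      by_contra hne
      dsimp only at h
      rcases hG.1 w w' hw.1 hw'.1 with ha | ha
      · have := G.card_below_lt (hG.2 w hw.1).ge ha (Ne.symm hne)
        omega
      · have := G.card_below_lt (hG.2 w' hw'.1).ge ha hne
        omega
  have h5 : (Finset.univ.filter fun w => ¬ G.IsLeaf w).card =
      (Finset.univ.filter fun w => ¬ G.IsLeaf w ∧ (G.below w).card < s).card +
      (Finset.univ.filter fun w => ¬ G.IsLeaf w ∧ ¬ (G.below w).card < s).card := by
    rw [← Finset.filter_filter, ← Finset.filter_filter, Finset.card_filter_add_card_filter_not]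
  set B := Finset.univ.filter fun w => ¬ G.IsLeaf w ∧ ¬ (G.below w).card < s with hB
  have h6 : (B.erase G.root).card ≤ (A.biUnion fun v : T.Inn => Finset.univ.filter fun w : G.Inn =>
      (T.below v.1).card ≤ (G.below w.1).card).card := by
    rw [← Finset.card_map (Function.Embedding.subtype _)]
    apply Finset.card_le_card
    intro w hw
    simp only [hB, Finset.mem_erase, Finset.mem_filter, Finset.mem_univ, true_and, not_lt] at hw
    simp only [Finset.mem_map, Finset.mem_biUnion, Finset.mem_filter, Finset.mem_univ, true_and,
      Function.Embedding.subtype_apply]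
    exact ⟨⟨w, hw.1, hw.2.1⟩, ⟨v, hv, hw.2.2⟩, rfl⟩
  have h7 : B.card ≤ (B.erase G.root).card + 1 := by
    have := Finset.pred_card_le_card_erase (s := B) (a := G.root)
    omega
  omega

theorem form_le (T : TreeOn V) (G : TreeOn W)
    (hT : ∀ v, T.childCount v ≠ 1) (hG : G.IsBinaryCaterpillar)
    (hn : Fintype.card T.Leaf = Fintype.card G.Leaf) (x : T.Leaf → ℝ) (hx : ∀ l, 0 ≤ x l) :
    ∃ e : G.Leaf ≃ T.Leaf,
      x ⬝ᵥ (T.ancMatrix *ᵥ x) ≤ (x ∘ e) ⬝ᵥ (G.ancMatrix *ᵥ (x ∘ e)) := by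
  obtain ⟨e, he⟩ := exists_equiv T G hn x
  refine ⟨e, ?_⟩
  by_cases hr : T.IsLeaf T.root
  · have h0 : x ⬝ᵥ (T.ancMatrix *ᵥ x) = 0 := by
      rw [quad_eq]
      apply Finset.sum_eq_zero
      intro u hu
      exact absurd (T.leaf_anc hr (T.anc_root u)) (by simpa using hu)
    rw [h0, quad_eq]
    exact Finset.sum_nonneg fun _ _ => sq_nonneg _
  have hrG : ¬ G.IsLeaf G.root := by
    intro h
    have h2 := T.two_le_card_below (T.childCount_ge (hT _) hr)
    rw [below_root, Finset.card_univ, hn] at h2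
    have h3 := G.below_leaf ⟨G.root, h⟩
    have h4 := congrArg Finset.card h3
    rw [below_root, Finset.card_univ, Finset.card_singleton] at h4
    omega
  obtain ⟨f, hf, hle⟩ := hall T G hT hG hn
  rw [T.quad_split hr, G.quad_split hrG]
  refine add_le_add (le_of_eq ?_) ?_
  · exact (Equiv.sum_comp e (fun l => x l ^ 2)).symm
  calc ∑ u : T.Inn, (∑ l ∈ T.below u.1, x l) ^ 2
      ≤ ∑ u : T.Inn, (∑ l ∈ G.below (f u).1, (x ∘ e) l) ^ 2 := by
        refine Finset.sum_le_sum fun u _ => ?_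
        refine pow_le_pow_left₀ (Finset.sum_nonneg fun l _ => hx l) ?_ 2
        have h1 : ∑ l ∈ T.below u.1, x l =
            ∑ l ∈ (T.below u.1).map e.symm.toEmbedding, (x ∘ e) l := by
          simp
        rw [h1]
        apply sum_le_of_sep
        · intro l; exact hx _
        · rw [Finset.card_map]; exact hle u
        · intro i hi j hj
          apply he
          rw [mem_below] at hi hj
          -- level of `i` exceeds that of `f u`
          have hw := (f u).2.2
          have hi1 : G.level (f u).1 < G.level i.1 := by
            by_contra hlt
            have := G.anc_eq hi (by omega)
            exact hw (this ▸ i.2)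
          have hjr : j.1 ≠ G.root := fun h => hrG (h ▸ j.2)
          have hj1 := G.level_parent hjr
          have hpl : ¬ G.IsLeaf (G.parent j.1) := by
            intro h
            have h2 := h j.1 rfl
            rw [← h2] at hj1
            omega
          have hna : ¬ G.IsAncestor (f u).1 (G.parent j.1) := fun h =>
            hj (G.anc_trans h (G.anc_parent_self _))
          have ha : G.IsAncestor (G.parent j.1) (f u).1 :=
            (hG.1 _ _ hw hpl).resolve_left hna
          have hlt : G.level (G.parent j.1) < G.level (f u).1 := by
            by_contra hge
            have := G.anc_eq ha (by omega)
            exact hna (this ▸ G.anc_refl _)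
          omega
    _ = ∑ w ∈ Finset.univ.map ⟨f, hf⟩, (∑ l ∈ G.below w.1, (x ∘ e) l) ^ 2 := by
        rw [Finset.sum_map]; rfl
    _ ≤ _ := Finset.sum_le_sum_of_subset_of_nonneg (Finset.subset_univ _)
        fun _ _ _ => sq_nonneg _

end main

end TreeOn

/-- Among all rooted trees with `n` leaves in which no vertex
has exactly one child, the binary caterpillar `C_n` maximises the ancestral
spectral radius. -/
theorem rhoC_le_rhoC_binaryCaterpillar
    {V W : Type} [Fintype V] [DecidableEq V] [Fintype W] [DecidableEq W]
    (T : TreeOn V) (G : TreeOn W)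
    (hT : ∀ v, T.childCount v ≠ 1)
    (hG : G.IsBinaryCaterpillar)
    (hn : Fintype.card T.Leaf = Fintype.card G.Leaf) :
    T.rhoC ≤ G.rhoC := by
  have hne : ({μ : ℝ | ∃ x : T.Leaf → ℝ, x ≠ 0 ∧ T.ancMatrix.mulVec x = μ • x}).Nonempty := by
    obtain ⟨l, hl, -⟩ := T.exists_leaf T.root
    have hH := T.symm_ancMatrix
    refine ⟨hH.eigenvalues ⟨l, hl⟩, hH.eigenvectorBasis ⟨l, hl⟩, ?_, ?_⟩
    · intro h0
      apply hH.eigenvectorBasis.orthonormal.ne_zero ⟨l, hl⟩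
      ext j
      exact congrFun h0 j
    · exact hH.mulVec_eigenvectorBasis ⟨l, hl⟩
  refine csSup_le hne ?_
  rintro μ ⟨x, hx, hμ⟩
  obtain ⟨e, he⟩ := TreeOn.form_le T G hT hG hn (fun l => |x l|) (fun l => abs_nonneg _)
  have h1 : x ⬝ᵥ (T.ancMatrix *ᵥ x) = μ * (x ⬝ᵥ x) := by
    rw [hμ, dotProduct_smul, smul_eq_mul]
  have h2 : x ⬝ᵥ (T.ancMatrix *ᵥ x) ≤
      (fun l => |x l|) ⬝ᵥ (T.ancMatrix *ᵥ (fun l => |x l|)) := by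
    rw [TreeOn.quad_eq, TreeOn.quad_eq]
    refine Finset.sum_le_sum fun u _ => ?_
    rw [← sq_abs]
    exact pow_le_pow_left₀ (abs_nonneg _) (Finset.abs_sum_le_sum_abs _ _) 2
  have h3 := G.rayleigh ((fun l => |x l|) ∘ e)
  have h4 : ((fun l => |x l|) ∘ e) ⬝ᵥ ((fun l => |x l|) ∘ e) = x ⬝ᵥ x := by
    simp only [dotProduct, Function.comp, abs_mul_abs_self]
    exact Equiv.sum_comp e (fun l => x l * x l)
  rw [h4] at h3
  have h5 : 0 < x ⬝ᵥ x := by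
    refine lt_of_le_of_ne (Finset.sum_nonneg fun i _ => mul_self_nonneg _) (Ne.symm ?_)
    rwa [Ne, dotProduct_self_eq_zero]
  refine le_of_mul_le_mul_right ?_ h5
  linarith
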